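/- arXiv:1710.02706 — 2 statements merged into one kernel-verified Lean document; each statement's English description precedes it below -/
import Mathlib

section
/- The supercommutator algebra of any right alternative superalgebra, equipped with the ternary product {x,y,z} := (-1)^{|x|(|y|+|z|)} as^J(y,z,x), is a Bol superalgebra, where [x,y] = (1/2)(xy - (-1)^{|x||y|}yx) and as^J(x,y,z) = (x∘y)∘z - x∘(y∘z) is the Jordan associator of the super-Jordan product x∘y = (1/2)(xy + (-1)^{|x||y|}yx). -/
namespace SuperAlg

/-- The sign `(-1)^{ab}` for degrees `a b : ZMod 2`. -/
def sgn (k : Type*) [Field k] (a b : ZMod 2) : k := (-1 : k) ^ (a.val * b.val)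

variable (k A : Type*) [Field k] [AddCommGroup A] [Module k A]

/-- Iterated composition of a linear self-map. -/
def lpow (f : A →ₗ[k] A) : ℕ → (A →ₗ[k] A)
  | 0 => LinearMap.id
  | (n + 1) => f.comp (lpow f n)

/-- A Bol superalgebra (axioms (SB1)-(SB5)). -/
structure BolSuper where
  grading : ZMod 2 → Submodule k A
  internal : DirectSum.IsInternal grading
  br : A →ₗ[k] A →ₗ[k] A
  tp : A →ₗ[k] A →ₗ[k] A →ₗ[k] A
  br_grade : ∀ (a b : ZMod 2) (x y : A), x ∈ grading a → y ∈ grading b →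
    br x y ∈ grading (a + b)
  tp_grade : ∀ (a b c : ZMod 2) (x y z : A), x ∈ grading a → y ∈ grading b → z ∈ grading c →
    tp x y z ∈ grading (a + b + c)
  sb1 : ∀ (a b : ZMod 2) (x y : A), x ∈ grading a → y ∈ grading b →
    br x y = - sgn k a b • br y x
  sb2 : ∀ (a b : ZMod 2) (x y z : A), x ∈ grading a → y ∈ grading b →
    tp x y z = - sgn k a b • tp y x z
  sb3 : ∀ (a b c : ZMod 2) (x y z : A), x ∈ grading a → y ∈ grading b → z ∈ grading c →
    tp x y z + sgn k a (b + c) • tp y z x + sgn k c (a + b) • tp z x y = 0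
  sb4 : ∀ (a b c d : ZMod 2) (x y u v : A), x ∈ grading a → y ∈ grading b →
      u ∈ grading c → v ∈ grading d →
    tp x y (br u v) = br (tp x y u) v + sgn k c (a + b) • br u (tp x y v)
      + sgn k (a + b) (c + d) • (tp u v (br x y) - br (br u v) (br x y))
  sb5 : ∀ (a b c d : ZMod 2) (x y u v w : A), x ∈ grading a → y ∈ grading b →
      u ∈ grading c → v ∈ grading d →
    tp x y (tp u v w) = tp (tp x y u) v w + sgn k c (a + b) • tp u (tp x y v) w
      + sgn k (a + b) (c + d) • tp u v (tp x y w)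

/-- A right alternative superalgebra. -/
structure RightAltSuper where
  grading : ZMod 2 → Submodule k A
  internal : DirectSum.IsInternal grading
  mul : A →ₗ[k] A →ₗ[k] A
  mul_grade : ∀ (a b : ZMod 2) (x y : A), x ∈ grading a → y ∈ grading b →
    mul x y ∈ grading (a + b)
  ralt : ∀ (a b c : ZMod 2) (x y z : A), x ∈ grading a → y ∈ grading b → z ∈ grading c →
    mul (mul x y) z - mul x (mul y z)
      = - sgn k b c • (mul (mul x z) y - mul x (mul z y))

/-- The super-Jordan product `x ∘ y = (1/2)(xy + (-1)^{|x||y|} yx)` on homogeneous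
elements of degrees `a`, `b`. -/
def jmul (R : RightAltSuper k A) (a b : ZMod 2) (x y : A) : A :=
  (2⁻¹ : k) • (R.mul x y + sgn k a b • R.mul y x)

/-- The Jordan associator `as^J(x,y,z)` of the super-Jordan product, on homogeneous
elements of degrees `a`, `b`, `c`. -/
def jassoc (R : RightAltSuper k A) (a b c : ZMod 2) (x y z : A) : A :=
  jmul k A R (a + b) c (jmul k A R a b x y) z - jmul k A R a (b + c) x (jmul k A R b c y z)

section Signs

lemma sgn_zero_left (b : ZMod 2) : sgn k 0 b = 1 := by simp [sgn]

lemma sgn_zero_right (a : ZMod 2) : sgn k a 0 = 1 := by simp [sgn]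

lemma sgn_one_one : sgn k 1 1 = -1 := by
  simp [sgn, show (1 : ZMod 2).val = 1 from rfl]

lemma zmod_two_one_add_one : (1 + 1 : ZMod 2) = 0 := by decide

lemma zmod_two_eq_zero_or_one (a : ZMod 2) : a = 0 ∨ a = 1 := by
  revert a; decide

end Signs

section Grading

variable {k A}

lemma exists_homogeneous_projections {G : ZMod 2 → Submodule k A}
    (h : DirectSum.IsInternal G) :
    ∃ π : ZMod 2 → A →ₗ[k] A, (∀ a x, π a x ∈ G a) ∧ (∀ a x, x ∈ G a → π a x = x) ∧
      (∀ a b x, x ∈ G a → b ≠ a → π b x = 0) ∧ ∀ x, π 0 x + π 1 x = x := by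
  let e : (DirectSum (ZMod 2) fun a => G a) ≃ₗ[k] A :=
    LinearEquiv.ofBijective (DirectSum.coeLinearMap G) h
  have he : ∀ a (x : G a), e.symm (x : A) = DirectSum.lof k _ (fun a => G a) a x := by
    intro a x
    rw [LinearEquiv.symm_apply_eq]
    exact (DirectSum.coeLinearMap_lof G a x).symm
  let π : ZMod 2 → A →ₗ[k] A := fun a =>
    (G a).subtype ∘ₗ DirectSum.component k _ (fun a => G a) a ∘ₗ e.symm.toLinearMap
  have hs : ∀ a x, x ∈ G a → π a x = x := by
    intro a x hx
    have := he a ⟨x, hx⟩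
    simp only at this
    simp [π, this, DirectSum.component.lof_self]
  have hn : ∀ a b x, x ∈ G a → b ≠ a → π b x = 0 := by
    intro a b x hx hab
    have := he a ⟨x, hx⟩
    simp only at this
    simp [π, this, DirectSum.component.of, hab.symm]
  refine ⟨π, fun a x => by simp [π], hs, hn, fun x => ?_⟩
  obtain ⟨y, rfl⟩ := e.surjective x
  induction y using DirectSum.induction_on with
  | zero => simp
  | add y z hy hz =>
    rw [map_add, map_add, map_add, add_add_add_comm, hy, hz]
  | of a y =>
    have hy : e (DirectSum.of (fun a => G a) a y) = y := DirectSum.coeLinearMap_lof G a y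
    rw [hy]
    rcases zmod_two_eq_zero_or_one a with rfl | rfl
    · rw [hs _ _ y.2, hn 0 1 _ y.2 (by decide), add_zero]
    · rw [hs _ _ y.2, hn 1 0 _ y.2 (by decide), zero_add]

lemma exists_eq_add_of_isInternal {G : ZMod 2 → Submodule k A}
    (h : DirectSum.IsInternal G) (x : A) : ∃ y ∈ G 0, ∃ z ∈ G 1, x = y + z := by
  obtain ⟨π, hm, -, -, hx⟩ := exists_homogeneous_projections h
  exact ⟨π 0 x, hm 0 x, π 1 x, hm 1 x, (hx x).symm⟩

lemma exists_bilinear_of_homogeneous {G : ZMod 2 → Submodule k A}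
    (h : DirectSum.IsInternal G) (T : ZMod 2 → ZMod 2 → A →ₗ[k] A →ₗ[k] A) :
    ∃ F : A →ₗ[k] A →ₗ[k] A, ∀ a b x y, x ∈ G a → y ∈ G b → F x y = T a b x y := by
  obtain ⟨π, -, hs, hn, -⟩ := exists_homogeneous_projections h
  refine ⟨∑ a, ∑ b, (T a b).compl₁₂ (π a) (π b), fun a b x y hx hy => ?_⟩
  simp only [LinearMap.sum_apply, LinearMap.compl₁₂_apply]
  rw [Finset.sum_eq_single a (fun a' _ ha => by simp [hn a a' x hx ha]) (by simp),
    Finset.sum_eq_single b (fun b' _ hb => by simp [hn b b' y hy hb]) (by simp),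
    hs a x hx, hs b y hy]

lemma exists_trilinear_of_homogeneous {G : ZMod 2 → Submodule k A}
    (h : DirectSum.IsInternal G)
    (T : ZMod 2 → ZMod 2 → ZMod 2 → A →ₗ[k] A →ₗ[k] A →ₗ[k] A) :
    ∃ F : A →ₗ[k] A →ₗ[k] A →ₗ[k] A, ∀ a b c x y z, x ∈ G a → y ∈ G b → z ∈ G c →
      F x y z = T a b c x y z := by
  obtain ⟨π, -, hs, hn, -⟩ := exists_homogeneous_projections h
  refine ⟨∑ a, ∑ b, ∑ c, ((T a b c).compl₁₂ (π a) (π b)).compr₂ (LinearMap.lcomp k A (π c)),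
    fun a b c x y z hx hy hz => ?_⟩
  simp only [LinearMap.sum_apply, LinearMap.compl₁₂_apply, LinearMap.compr₂_apply,
    LinearMap.lcomp_apply]
  rw [Finset.sum_eq_single a (fun a' _ ha => by simp [hn a a' x hx ha]) (by simp),
    Finset.sum_eq_single b (fun b' _ hb => by simp [hn b b' y hy hb]) (by simp),
    Finset.sum_eq_single c (fun c' _ hc => by simp [hn c c' z hz hc]) (by simp),
    hs a x hx, hs b y hy, hs c z hz]

end Grading

section RightAlternative

variable {k A} (R : RightAltSuper k A)

lemma jmul_mem {a b : ZMod 2} {x y : A} (hx : x ∈ R.grading a) (hy : y ∈ R.grading b) :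
    jmul k A R a b x y ∈ R.grading (a + b) :=
  Submodule.smul_mem _ _ (add_mem (R.mul_grade _ _ _ _ hx hy)
    (Submodule.smul_mem _ _ (add_comm b a ▸ R.mul_grade _ _ _ _ hy hx)))

/-- Right multiplication is a homomorphism for the super-Jordan product. -/
lemma mul_jmul {a b : ZMod 2} {x y : A} (hx : x ∈ R.grading a) (hy : y ∈ R.grading b) (p : A) :
    R.mul p (jmul k A R a b x y) =
      (2⁻¹ : k) • (R.mul (R.mul p x) y + sgn k a b • R.mul (R.mul p y) x) := by
  have key : ∀ c q, q ∈ R.grading c → R.mul q (jmul k A R a b x y) =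
      (2⁻¹ : k) • (R.mul (R.mul q x) y + sgn k a b • R.mul (R.mul q y) x) := by
    intro c q hq
    have h := R.ralt c a b q x y hq hx hy
    rw [sub_eq_iff_eq_add] at h
    rw [jmul, map_smul, map_add, map_smul, h]
    module
  obtain ⟨q, hq, r, hr, rfl⟩ := exists_eq_add_of_isInternal R.internal p
  simp only [map_add, LinearMap.add_apply, key _ _ hq, key _ _ hr]
  module

/-- The signed Jordan associator, expanded into left-normed products by right alternativity. -/
noncomputable def tripleAux (a b c : ZMod 2) : A →ₗ[k] A →ₗ[k] A →ₗ[k] A :=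
  (2⁻¹ * 2⁻¹ : k) • (R.mul.compr₂ R.mul - sgn k a b • R.mul.flip.compr₂ R.mul
    - sgn k c (a + b) •
      (((LinearMap.llcomp k A A A).compl₁₂ R.mul.flip R.mul.flip).flip
        - sgn k a b • (LinearMap.llcomp k A A A).compl₁₂ R.mul.flip R.mul.flip))

lemma tripleAux_apply (a b c : ZMod 2) (x y z : A) :
    tripleAux R a b c x y z = (2⁻¹ * 2⁻¹ : k) •
      (R.mul (R.mul x y) z - sgn k a b • R.mul (R.mul y x) z
        - sgn k c (a + b) • (R.mul (R.mul z x) y - sgn k a b • R.mul (R.mul z y) x)) := by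
  simp [tripleAux]

lemma tripleAux_eq_jassoc {a b c : ZMod 2} {x y z : A} (hx : x ∈ R.grading a)
    (hy : y ∈ R.grading b) (hz : z ∈ R.grading c) :
    tripleAux R a b c x y z = sgn k a (b + c) • jassoc k A R b c a y z x := by
  rw [tripleAux_apply, jassoc, jmul, mul_jmul R hy hz, jmul, jmul, mul_jmul R hz hx]
  simp only [jmul, map_add, map_smul, LinearMap.add_apply, LinearMap.smul_apply]
  rcases zmod_two_eq_zero_or_one a with rfl | rfl <;>
  rcases zmod_two_eq_zero_or_one b with rfl | rfl <;>
  rcases zmod_two_eq_zero_or_one c with rfl | rfl <;>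
  simp only [zmod_two_one_add_one, add_zero, zero_add, sgn_zero_left, sgn_zero_right,
    sgn_one_one] <;>
  module

lemma mul_tripleAux {a b c : ZMod 2} {x y z : A} (hx : x ∈ R.grading a)
    (hy : y ∈ R.grading b) (hz : z ∈ R.grading c) (p : A) :
    R.mul p (tripleAux R a b c x y z) = (2⁻¹ * 2⁻¹ : k) •
      (R.mul (R.mul (R.mul p x) y) z - sgn k a b • R.mul (R.mul (R.mul p y) x) z
        - sgn k c (a + b) • (R.mul (R.mul (R.mul p z) x) y
          - sgn k a b • R.mul (R.mul (R.mul p z) y) x)) := by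
  rw [tripleAux_eq_jassoc R hx hy hz, jassoc, map_smul, map_sub,
    mul_jmul R (jmul_mem R hy hz) hx, mul_jmul R hy (jmul_mem R hz hx),
    mul_jmul R hy hz, mul_jmul R hz hx, mul_jmul R hy hz, mul_jmul R hz hx]
  simp only [map_add, map_smul, LinearMap.add_apply, LinearMap.smul_apply]
  rcases zmod_two_eq_zero_or_one a with rfl | rfl <;>
  rcases zmod_two_eq_zero_or_one b with rfl | rfl <;>
  rcases zmod_two_eq_zero_or_one c with rfl | rfl <;>
  simp only [zmod_two_one_add_one, add_zero, zero_add, sgn_zero_left, sgn_zero_right,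
    sgn_one_one] <;>
  module

lemma tripleAux_mem {a b c : ZMod 2} {x y z : A} (hx : x ∈ R.grading a)
    (hy : y ∈ R.grading b) (hz : z ∈ R.grading c) :
    tripleAux R a b c x y z ∈ R.grading (a + b + c) := by
  have h : b + c + a = a + b + c := by ring
  have h' : b + (c + a) = a + b + c := by ring
  rw [tripleAux_eq_jassoc R hx hy hz]
  exact Submodule.smul_mem _ _ (sub_mem (h ▸ jmul_mem R (jmul_mem R hy hz) hx)
    (h' ▸ jmul_mem R hy (jmul_mem R hz hx)))

/-- The halved supercommutator on homogeneous elements of degrees `a`, `b`. -/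
noncomputable def bracketAux (a b : ZMod 2) : A →ₗ[k] A →ₗ[k] A :=
  (2⁻¹ : k) • (R.mul - sgn k a b • R.mul.flip)

lemma bracketAux_apply (a b : ZMod 2) (x y : A) :
    bracketAux R a b x y = (2⁻¹ : k) • (R.mul x y - sgn k a b • R.mul y x) := by
  simp [bracketAux]

lemma bracketAux_mem {a b : ZMod 2} {x y : A} (hx : x ∈ R.grading a)
    (hy : y ∈ R.grading b) : bracketAux R a b x y ∈ R.grading (a + b) := by
  rw [bracketAux_apply]
  exact Submodule.smul_mem _ _ (sub_mem (R.mul_grade _ _ _ _ hx hy)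
    (Submodule.smul_mem _ _ (add_comm b a ▸ R.mul_grade _ _ _ _ hy hx)))

set_option maxHeartbeats 4000000 in
lemma tripleAux_bracketAux {a b c d : ZMod 2} {x y u v : A} (hx : x ∈ R.grading a)
    (hy : y ∈ R.grading b) (hu : u ∈ R.grading c) (hv : v ∈ R.grading d) :
    tripleAux R a b (c + d) x y (bracketAux R c d u v) =
      bracketAux R (a + b + c) d (tripleAux R a b c x y u) v
      + sgn k c (a + b) • bracketAux R c (a + b + d) u (tripleAux R a b d x y v)
      + sgn k (a + b) (c + d) • (tripleAux R c d (a + b) u v (bracketAux R a b x y)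
        - bracketAux R (c + d) (a + b) (bracketAux R c d u v) (bracketAux R a b x y)) := by
  simp only [bracketAux_apply, mul_tripleAux R hx hy hu, mul_tripleAux R hx hy hv]
  simp only [tripleAux_apply, map_sub, map_smul,
    LinearMap.sub_apply, LinearMap.smul_apply]
  generalize (2⁻¹ : k) = h
  rcases zmod_two_eq_zero_or_one a with rfl | rfl <;>
  rcases zmod_two_eq_zero_or_one b with rfl | rfl <;>
  rcases zmod_two_eq_zero_or_one c with rfl | rfl <;>
  rcases zmod_two_eq_zero_or_one d with rfl | rfl <;>
  simp only [zmod_two_one_add_one, add_zero, zero_add, sgn_zero_left, sgn_zero_right,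
    sgn_one_one] <;>
  module

set_option maxHeartbeats 4000000 in
lemma tripleAux_tripleAux {a b c d e : ZMod 2} {x y u v w : A} (hx : x ∈ R.grading a)
    (hy : y ∈ R.grading b) (hu : u ∈ R.grading c) (hv : v ∈ R.grading d)
    (hw : w ∈ R.grading e) :
    tripleAux R a b (c + d + e) x y (tripleAux R c d e u v w) =
      tripleAux R (a + b + c) d e (tripleAux R a b c x y u) v w
      + sgn k c (a + b) • tripleAux R c (a + b + d) e u (tripleAux R a b d x y v) w
      + sgn k (a + b) (c + d) • tripleAux R c d (a + b + e) u v (tripleAux R a b e x y w) := by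
  rw [tripleAux_apply R a b (c + d + e), tripleAux_apply R (a + b + c) d e,
    tripleAux_apply R c (a + b + d) e, tripleAux_apply R c d (a + b + e)]
  simp only [mul_tripleAux R hx hy hu, mul_tripleAux R hx hy hv, mul_tripleAux R hx hy hw,
    mul_tripleAux R hu hv hw]
  simp only [tripleAux_apply, map_sub, map_smul,
    LinearMap.sub_apply, LinearMap.smul_apply]
  generalize (2⁻¹ : k) = h
  rcases zmod_two_eq_zero_or_one a with rfl | rfl <;>
  rcases zmod_two_eq_zero_or_one b with rfl | rfl <;>
  rcases zmod_two_eq_zero_or_one c with rfl | rfl <;>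
  rcases zmod_two_eq_zero_or_one d with rfl | rfl <;>
  rcases zmod_two_eq_zero_or_one e with rfl | rfl <;>
  simp only [zmod_two_one_add_one, add_zero, zero_add, sgn_zero_left, sgn_zero_right,
    sgn_one_one] <;>
  module

lemma bracketAux_swap (a b : ZMod 2) (x y : A) :
    bracketAux R a b x y = - sgn k a b • bracketAux R b a y x := by
  simp only [bracketAux_apply]
  rcases zmod_two_eq_zero_or_one a with rfl | rfl <;>
  rcases zmod_two_eq_zero_or_one b with rfl | rfl <;>
  simp only [sgn_zero_left, sgn_zero_right, sgn_one_one] <;>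
  module

lemma tripleAux_swap (a b c : ZMod 2) (x y z : A) :
    tripleAux R a b c x y z = - sgn k a b • tripleAux R b a c y x z := by
  simp only [tripleAux_apply]
  rcases zmod_two_eq_zero_or_one a with rfl | rfl <;>
  rcases zmod_two_eq_zero_or_one b with rfl | rfl <;>
  simp only [add_zero, zero_add, sgn_zero_left, sgn_zero_right, sgn_one_one] <;>
  module

lemma tripleAux_cyclic (a b c : ZMod 2) (x y z : A) :
    tripleAux R a b c x y z + sgn k a (b + c) • tripleAux R b c a y z x
      + sgn k c (a + b) • tripleAux R c a b z x y = 0 := by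
  simp only [tripleAux_apply]
  rcases zmod_two_eq_zero_or_one a with rfl | rfl <;>
  rcases zmod_two_eq_zero_or_one b with rfl | rfl <;>
  rcases zmod_two_eq_zero_or_one c with rfl | rfl <;>
  simp only [zmod_two_one_add_one, add_zero, zero_add, sgn_zero_left, sgn_zero_right,
    sgn_one_one] <;>
  module

end RightAlternative

/-- Theorem 3.1: the supercommutator algebra of any right alternative superalgebra,
with the ternary product `{x,y,z} = (-1)^{|x|(|y|+|z|)} as^J(y,z,x)`, is a Bol superalgebra. -/
theorem rightAltSuper_bolSuper (R : RightAltSuper k A) :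
    ∃ B : BolSuper k A, B.grading = R.grading ∧
      (∀ (a b : ZMod 2) (x y : A), x ∈ R.grading a → y ∈ R.grading b →
        B.br x y = (2⁻¹ : k) • (R.mul x y - sgn k a b • R.mul y x)) ∧
      (∀ (a b c : ZMod 2) (x y z : A), x ∈ R.grading a → y ∈ R.grading b → z ∈ R.grading c →
        B.tp x y z = sgn k a (b + c) • jassoc k A R b c a y z x) := by
  obtain ⟨br, hbr⟩ := exists_bilinear_of_homogeneous R.internal (bracketAux R)
  obtain ⟨tp, htp⟩ := exists_trilinear_of_homogeneous R.internal (tripleAux R)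
  have hbr_mem : ∀ (a b : ZMod 2) (x y : A), x ∈ R.grading a → y ∈ R.grading b →
      br x y ∈ R.grading (a + b) := fun a b x y hx hy => by
    rw [hbr a b x y hx hy]
    exact bracketAux_mem R hx hy
  have htp_mem : ∀ (a b c : ZMod 2) (x y z : A), x ∈ R.grading a → y ∈ R.grading b →
      z ∈ R.grading c → tp x y z ∈ R.grading (a + b + c) := fun a b c x y z hx hy hz => by
    rw [htp a b c x y z hx hy hz]
    exact tripleAux_mem R hx hy hz
  refine ⟨{ grading := R.grading, internal := R.internal, br := br, tp := tp,
            br_grade := hbr_mem, tp_grade := htp_mem,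
            sb1 := ?_, sb2 := ?_, sb3 := ?_, sb4 := ?_, sb5 := ?_ }, rfl, ?_, ?_⟩
  · intro a b x y hx hy
    rw [hbr a b x y hx hy, hbr b a y x hy hx]
    exact bracketAux_swap R a b x y
  · intro a b x y z hx hy
    obtain ⟨z₀, h₀, z₁, h₁, rfl⟩ := exists_eq_add_of_isInternal R.internal z
    rw [map_add, map_add, htp a b 0 x y z₀ hx hy h₀, htp a b 1 x y z₁ hx hy h₁,
      htp b a 0 y x z₀ hy hx h₀, htp b a 1 y x z₁ hy hx h₁,
      tripleAux_swap R a b 0, tripleAux_swap R a b 1, smul_add]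
  · intro a b c x y z hx hy hz
    rw [htp a b c x y z hx hy hz, htp b c a y z x hy hz hx, htp c a b z x y hz hx hy]
    exact tripleAux_cyclic R a b c x y z
  · intro a b c d x y u v hx hy hu hv
    rw [htp a b (c + d) x y _ hx hy (hbr_mem c d u v hu hv),
      hbr (a + b + c) d _ v (htp_mem a b c x y u hx hy hu) hv,
      hbr c (a + b + d) u _ hu (htp_mem a b d x y v hx hy hv),
      htp c d (a + b) u v _ hu hv (hbr_mem a b x y hx hy),
      hbr (c + d) (a + b) _ _ (hbr_mem c d u v hu hv) (hbr_mem a b x y hx hy),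
      hbr c d u v hu hv, hbr a b x y hx hy, htp a b c x y u hx hy hu, htp a b d x y v hx hy hv]
    exact tripleAux_bracketAux R hx hy hu hv
  · intro a b c d x y u v w hx hy hu hv
    have key : ∀ e w, w ∈ R.grading e → tp x y (tp u v w) = tp (tp x y u) v w
        + sgn k c (a + b) • tp u (tp x y v) w
        + sgn k (a + b) (c + d) • tp u v (tp x y w) := by
      intro e w hw
      rw [htp a b (c + d + e) x y _ hx hy (htp_mem c d e u v w hu hv hw),
        htp (a + b + c) d e _ v w (htp_mem a b c x y u hx hy hu) hv hw,
        htp c (a + b + d) e u _ w hu (htp_mem a b d x y v hx hy hv) hw,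
        htp c d (a + b + e) u v _ hu hv (htp_mem a b e x y w hx hy hw),
        htp c d e u v w hu hv hw, htp a b c x y u hx hy hu, htp a b d x y v hx hy hv,
        htp a b e x y w hx hy hw]
      exact tripleAux_tripleAux R hx hy hu hv hw
    obtain ⟨w₀, h₀, w₁, h₁, rfl⟩ := exists_eq_add_of_isInternal R.internal w
    simp only [map_add, key 0 w₀ h₀, key 1 w₁ h₁, smul_add]
    abel
  · intro a b x y hx hy
    exact (hbr a b x y hx hy).trans (bracketAux_apply R a b x y)
  · intro a b c x y z hx hy hz
    exact (htp a b c x y z hx hy hz).trans (tripleAux_eq_jassoc R hx hy hz)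

end SuperAlg
end

section
/- If A is a right alternative superalgebra, then (A, ∘) with super-Jordan product x∘y = (1/2)(xy + (-1)^{|x||y|}yx) together with the ternary product [x,y,z] := 2(-1)^{|x|(|y|+|z|)} as^J(y,z,x) is a Lie supertriple system. -/
namespace SuperAlg

variable (k A : Type*) [Field k] [AddCommGroup A] [Module k A]

/-- A Lie supertriple system. -/
structure LieSupertriple where
  grading : ZMod 2 → Submodule k A
  internal : DirectSum.IsInternal grading
  tp : A →ₗ[k] A →ₗ[k] A →ₗ[k] A
  tp_grade : ∀ (a b c : ZMod 2) (x y z : A), x ∈ grading a → y ∈ grading b → z ∈ grading c →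
    tp x y z ∈ grading (a + b + c)
  anti : ∀ (a b : ZMod 2) (x y z : A), x ∈ grading a → y ∈ grading b →
    tp x y z = - sgn k a b • tp y x z
  cyclic : ∀ (a b c : ZMod 2) (x y z : A), x ∈ grading a → y ∈ grading b → z ∈ grading c →
    tp x y z + sgn k a (b + c) • tp y z x + sgn k c (a + b) • tp z x y = 0
  deriv : ∀ (a b c d : ZMod 2) (x y u v w : A), x ∈ grading a → y ∈ grading b →
      u ∈ grading c → v ∈ grading d →
    tp x y (tp u v w) = tp (tp x y u) v w + sgn k c (a + b) • tp u (tp x y v) w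
      + sgn k (a + b) (c + d) • tp u v (tp x y w)

section Sign

variable {k}

theorem sgn_comm (a b : ZMod 2) : sgn k a b = sgn k b a := by
  simp only [sgn, mul_comm]

theorem sgn_add_right (a b c : ZMod 2) : sgn k a (b + c) = sgn k a b * sgn k a c := by
  have h : ∀ a b c : ZMod 2, a.val * (b + c).val % 2 = (a.val * b.val + a.val * c.val) % 2 := by
    decide
  rw [sgn, sgn, sgn, ← pow_add, neg_one_pow_eq_pow_mod_two, h, ← neg_one_pow_eq_pow_mod_two]

theorem sgn_add_left (a b c : ZMod 2) : sgn k (a + b) c = sgn k a c * sgn k b c := by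
  rw [sgn_comm, sgn_add_right, sgn_comm c a, sgn_comm c b]

theorem sgn_mul_self (a b : ZMod 2) : sgn k a b * sgn k a b = 1 := by
  rw [sgn, ← pow_add, Even.neg_one_pow ⟨_, rfl⟩]

end Sign

section Commutator

variable {k} {B : Type*} [Ring B] [Algebra k B]

/-- The commutator `X * Y - s • (Y * X)` twisted by a scalar `s`. -/
def twistedComm (s : k) (X Y : B) : B := X * Y - s • (Y * X)

theorem twistedComm_smul_left (s r : k) (X Y : B) :
    twistedComm s (r • X) Y = r • twistedComm s X Y := by
  simp only [twistedComm, smul_mul_assoc, mul_smul_comm]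
  module

theorem twistedComm_smul_right (s r : k) (X Y : B) :
    twistedComm s X (r • Y) = r • twistedComm s X Y := by
  simp only [twistedComm, smul_mul_assoc, mul_smul_comm]
  module

theorem twistedComm_add_left (s : k) (X X' Y : B) :
    twistedComm s (X + X') Y = twistedComm s X Y + twistedComm s X' Y := by
  simp only [twistedComm, add_mul, mul_add]
  module

/-- The graded Leibniz rule for twisted commutators. -/
theorem twistedComm_leibniz {s : k} (hs : s * s = 1) (t r : k) (D X Y : B) :
    twistedComm (s * t) D (twistedComm r X Y)
      = twistedComm (t * r) (twistedComm s D X) Y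
        + s • twistedComm (s * r) X (twistedComm t D Y) := by
  simp only [twistedComm, smul_mul_assoc, mul_smul_comm, mul_sub, sub_mul, mul_assoc]
  match_scalars <;> grind

/-- A twisted commutator acts as a graded derivation on the triple product `[[U, V], W]`. -/
theorem twistedComm_triple {s t : k} (hs : s * s = 1) (ht : t * t = 1) (q r p v : k)
    (D U V W : B) :
    twistedComm (s * t * q) D (twistedComm (p * v) (twistedComm r U V) W)
      = twistedComm (q * (p * v)) (twistedComm (t * r) (twistedComm s D U) V) W
        + s • twistedComm (q * (p * v)) (twistedComm (s * r) U (twistedComm t D V)) W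
        + (s * t) • twistedComm (s * t * (p * v)) (twistedComm r U V) (twistedComm q D W) := by
  rw [twistedComm_leibniz (by linear_combination t * t * hs + ht), twistedComm_leibniz hs,
    twistedComm_add_left, twistedComm_smul_left]

end Commutator

namespace RightAltSuper

variable {k A} (R : RightAltSuper k A)

/-- The projection onto the homogeneous component of degree `a`. -/
noncomputable def proj (a : ZMod 2) : A →ₗ[k] A :=
  (R.grading a).subtype ∘ₗ DirectSum.component k _ _ a ∘ₗ
    (LinearEquiv.ofBijective (DirectSum.coeLinearMap R.grading) R.internal).symm.toLinearMap

theorem proj_of_mem {a b : ZMod 2} {x : A} (hx : x ∈ R.grading a) :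
    R.proj b x = if a = b then x else 0 := by
  split_ifs with h
  · subst h
    exact congrArg Subtype.val (R.internal.ofBijective_coeLinearMap_of_mem hx)
  · exact congrArg Subtype.val (R.internal.ofBijective_coeLinearMap_of_mem_ne h hx)

/-- A map given on each pair of degrees by a bilinear map, assembled into one bilinear map. -/
noncomputable def glue {M : Type*} [AddCommGroup M] [Module k M]
    (f : ZMod 2 → ZMod 2 → A →ₗ[k] A →ₗ[k] M) : A →ₗ[k] A →ₗ[k] M :=
  ∑ a, ∑ b, (f a b).compl₁₂ (R.proj a) (R.proj b)

theorem glue_of_mem {M : Type*} [AddCommGroup M] [Module k M]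
    (f : ZMod 2 → ZMod 2 → A →ₗ[k] A →ₗ[k] M) {a b : ZMod 2} {x y : A}
    (hx : x ∈ R.grading a) (hy : y ∈ R.grading b) : R.glue f x y = f a b x y := by
  simp only [glue, LinearMap.sum_apply, LinearMap.compl₁₂_apply, R.proj_of_mem hx,
    R.proj_of_mem hy]
  rw [Finset.sum_eq_single a, Finset.sum_eq_single b] <;> simp +contextual [eq_comm]

/-- The super-Jordan product as a bilinear map. -/
noncomputable def jordan : A →ₗ[k] A →ₗ[k] A :=
  R.glue fun a b => (2⁻¹ : k) • (R.mul + sgn k a b • R.mul.flip)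

theorem jordan_of_mem {a b : ZMod 2} {x y : A} (hx : x ∈ R.grading a) (hy : y ∈ R.grading b) :
    R.jordan x y = jmul k A R a b x y := by
  simp [jordan, R.glue_of_mem _ hx hy, jmul]

theorem jordan_mem {a b : ZMod 2} {x y : A} (hx : x ∈ R.grading a) (hy : y ∈ R.grading b) :
    R.jordan x y ∈ R.grading (a + b) := by
  rw [R.jordan_of_mem hx hy]
  exact Submodule.smul_mem _ _ (Submodule.add_mem _ (R.mul_grade a b x y hx hy)
    (Submodule.smul_mem _ _ (add_comm b a ▸ R.mul_grade b a y x hy hx)))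

theorem jordan_comm {a b : ZMod 2} {x y : A} (hx : x ∈ R.grading a) (hy : y ∈ R.grading b) :
    R.jordan x y = sgn k a b • R.jordan y x := by
  rw [R.jordan_of_mem hx hy, R.jordan_of_mem hy hx, jmul, jmul, sgn_comm b a]
  have h := sgn_mul_self (k := k) a b
  match_scalars <;> grind

/-- The triple product `2 [L_x, L_y] z`, where `L` is left multiplication in the super-Jordan
product. -/
noncomputable def triple : A →ₗ[k] A →ₗ[k] A →ₗ[k] A :=
  R.glue fun a b => (2 : k) •
    ((LinearMap.mul k (Module.End k A)).compl₁₂ R.jordan R.jordan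
      - sgn k a b • (LinearMap.mul k (Module.End k A)).flip.compl₁₂ R.jordan R.jordan)

theorem triple_of_mem {a b : ZMod 2} {x y : A} (hx : x ∈ R.grading a) (hy : y ∈ R.grading b)
    (z : A) : R.triple x y z
      = (2 : k) • (R.jordan x (R.jordan y z) - sgn k a b • R.jordan y (R.jordan x z)) := by
  simp [triple, R.glue_of_mem _ hx hy]

theorem triple_mem {a b c : ZMod 2} {x y z : A} (hx : x ∈ R.grading a) (hy : y ∈ R.grading b)
    (hz : z ∈ R.grading c) : R.triple x y z ∈ R.grading (a + b + c) := by
  rw [R.triple_of_mem hx hy]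
  refine Submodule.smul_mem _ _ (Submodule.sub_mem _ ?_ (Submodule.smul_mem _ _ ?_))
  · exact add_assoc a b c ▸ R.jordan_mem hx (R.jordan_mem hy hz)
  · rw [add_comm a b, add_assoc]
    exact R.jordan_mem hy (R.jordan_mem hx hz)

theorem triple_anti {a b : ZMod 2} {x y : A} (hx : x ∈ R.grading a) (hy : y ∈ R.grading b)
    (z : A) : R.triple x y z = -sgn k a b • R.triple y x z := by
  rw [R.triple_of_mem hx hy, R.triple_of_mem hy hx, sgn_comm b a]
  have h := sgn_mul_self (k := k) a b
  match_scalars <;> grind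

theorem triple_cyclic {a b c : ZMod 2} {x y z : A} (hx : x ∈ R.grading a)
    (hy : y ∈ R.grading b) (hz : z ∈ R.grading c) :
    R.triple x y z + sgn k a (b + c) • R.triple y z x + sgn k c (a + b) • R.triple z x y = 0 := by
  rw [R.triple_of_mem hx hy, R.triple_of_mem hy hz, R.triple_of_mem hz hx, R.jordan_comm hz hx,
    R.jordan_comm hz hy, R.jordan_comm hy hx]
  simp only [map_smul, sgn_add_right, sgn_comm c a, sgn_comm c b, sgn_comm b a]
  have h₁ := sgn_mul_self (k := k) a b
  have h₂ := sgn_mul_self (k := k) a c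
  have h₃ := sgn_mul_self (k := k) b c
  match_scalars <;> grind

theorem triple_eq_jassoc {a b c : ZMod 2} {x y z : A} (hx : x ∈ R.grading a)
    (hy : y ∈ R.grading b) (hz : z ∈ R.grading c) :
    R.triple x y z = (2 : k) • sgn k a (b + c) • jassoc k A R b c a y z x := by
  rw [jassoc, ← R.jordan_of_mem hy hz, ← R.jordan_of_mem (R.jordan_mem hy hz) hx,
    ← R.jordan_of_mem hz hx, ← R.jordan_of_mem hy (R.jordan_mem hz hx), R.triple_of_mem hx hy,
    R.jordan_comm (R.jordan_mem hy hz) hx, R.jordan_comm hz hx]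
  simp only [map_smul, sgn_add_right, sgn_add_left, sgn_comm c a, sgn_comm b a]
  have h₁ := sgn_mul_self (k := k) a b
  have h₂ := sgn_mul_self (k := k) a c
  match_scalars <;> grind

/-- Right multiplication on the unital hull `k × A`, with values in the opposite of the
endomorphism algebra. -/
noncomputable def rightMul : A →ₗ[k] (Module.End k (k × A))ᵐᵒᵖ :=
  (MulOpposite.opLinearEquiv k).toLinearMap ∘ₗ
    { toFun := fun x => LinearMap.inr k k A ∘ₗ
        (LinearMap.toSpanSingleton k A x).coprod (R.mul.flip x)
      map_add' := fun x y => by ext <;> simp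
      map_smul' := fun r x => by ext <;> simp }

theorem unop_rightMul_apply (x : A) (p : k × A) :
    (R.rightMul x).unop p = (0, p.1 • x + R.mul p.2 x) := by
  simp [rightMul]

theorem rightMul_injective : Function.Injective R.rightMul := fun x y h => by
  simpa [unop_rightMul_apply] using congrArg (fun f => f.unop (1, 0)) h

theorem mul_mul_add_sgn_smul {a b : ZMod 2} {x y : A} (hx : x ∈ R.grading a)
    (hy : y ∈ R.grading b) (w : A) :
    R.mul w (R.mul x y) + sgn k a b • R.mul w (R.mul y x)
      = R.mul (R.mul w x) y + sgn k a b • R.mul (R.mul w y) x := by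
  induction w using Submodule.iSup_induction R.grading (motive := fun _ => _)
    (by rw [R.internal.submodule_iSup_eq_top]; trivial) with
  | zero => simp
  | add u v hu hv =>
    simp only [map_add, LinearMap.add_apply, smul_add]
    linear_combination (norm := module) hu + hv
  | mem c w hw =>
    have h := R.ralt c a b w x y hw hx hy
    linear_combination (norm := module) -h

theorem rightMul_jordan {a b : ZMod 2} {x y : A} (hx : x ∈ R.grading a) (hy : y ∈ R.grading b) :
    R.rightMul (R.jordan x y) = (2⁻¹ : k) •
      (R.rightMul x * R.rightMul y + sgn k a b • (R.rightMul y * R.rightMul x)) := by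
  apply MulOpposite.unop_injective
  refine LinearMap.ext fun p => Prod.ext ?_ ?_
  · simp [unop_rightMul_apply]
  · have h := R.mul_mul_add_sgn_smul hx hy p.2
    simp only [R.jordan_of_mem hx hy, jmul, unop_rightMul_apply, MulOpposite.unop_smul,
      MulOpposite.unop_add, MulOpposite.unop_mul, LinearMap.smul_apply, LinearMap.add_apply,
      Module.End.mul_apply, map_smul, map_add, Prod.smul_snd, Prod.snd_add, zero_smul, zero_add]
    linear_combination (norm := module) (2⁻¹ : k) • h

/-- In the right multiplication algebra the triple product is an iterated supercommutator. -/
theorem rightMul_triple {a b c : ZMod 2} {x y z : A} (hx : x ∈ R.grading a)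
    (hy : y ∈ R.grading b) (hz : z ∈ R.grading c) :
    R.rightMul (R.triple x y z) = (2⁻¹ : k) • twistedComm (sgn k (a + b) c)
      (twistedComm (sgn k a b) (R.rightMul x) (R.rightMul y)) (R.rightMul z) := by
  have h2 : (2 : k) * (2⁻¹ * 2⁻¹) = 2⁻¹ := by
    rcases eq_or_ne (2 : k) 0 with h | h
    · simp [h]
    · rw [mul_inv_cancel_left₀ h]
  have h₁ := sgn_mul_self (k := k) a b
  rw [R.triple_of_mem hx hy, map_smul, map_sub, map_smul,
    R.rightMul_jordan hx (R.jordan_mem hy hz), R.rightMul_jordan hy (R.jordan_mem hx hz),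
    R.rightMul_jordan hx hz, R.rightMul_jordan hy hz]
  simp only [twistedComm, sgn_add_left, sgn_add_right, sgn_comm b a, mul_add, add_mul, mul_sub,
    sub_mul, smul_mul_assoc, mul_smul_comm, mul_assoc]
  match_scalars <;> grind

theorem triple_deriv {a b c d : ZMod 2} {x y u v : A} (hx : x ∈ R.grading a)
    (hy : y ∈ R.grading b) (hu : u ∈ R.grading c) (hv : v ∈ R.grading d) (w : A) :
    R.triple x y (R.triple u v w) = R.triple (R.triple x y u) v w
      + sgn k c (a + b) • R.triple u (R.triple x y v) w
      + sgn k (a + b) (c + d) • R.triple u v (R.triple x y w) := by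
  induction w using Submodule.iSup_induction R.grading (motive := fun _ => _)
    (by rw [R.internal.submodule_iSup_eq_top]; trivial) with
  | zero => simp
  | add w w' h h' =>
    simp only [map_add, smul_add, h, h']
    abel
  | mem e w hw =>
    apply R.rightMul_injective
    have key := twistedComm_triple (sgn_mul_self (k := k) (a + b) c)
      (sgn_mul_self (k := k) (a + b) d) (sgn k (a + b) e) (sgn k c d) (sgn k c e) (sgn k d e)
      (twistedComm (sgn k a b) (R.rightMul x) (R.rightMul y))
      (R.rightMul u) (R.rightMul v) (R.rightMul w)
    rw [map_add, map_add, map_smul, map_smul, R.rightMul_triple hx hy (R.triple_mem hu hv hw),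
      R.rightMul_triple hu hv hw, R.rightMul_triple (R.triple_mem hx hy hu) hv hw,
      R.rightMul_triple hx hy hu, R.rightMul_triple hu (R.triple_mem hx hy hv) hw,
      R.rightMul_triple hx hy hv, R.rightMul_triple hu hv (R.triple_mem hx hy hw),
      R.rightMul_triple hx hy hw]
    have e₁ : sgn k (a + b) (c + d + e) = sgn k (a + b) c * sgn k (a + b) d * sgn k (a + b) e := by
      rw [sgn_add_right, sgn_add_right]
    have e₂ : sgn k (a + b + c + d) e = sgn k (a + b) e * (sgn k c e * sgn k d e) := by
      rw [sgn_add_left, sgn_add_left, mul_assoc]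
    have e₃ : sgn k (c + (a + b + d)) e = sgn k (a + b) e * (sgn k c e * sgn k d e) := by
      rw [sgn_add_left, sgn_add_left, mul_left_comm]
    have e₄ : sgn k (c + d) (a + b + e)
        = sgn k (a + b) c * sgn k (a + b) d * (sgn k c e * sgn k d e) := by
      rw [sgn_add_right, sgn_comm (c + d), sgn_add_right, sgn_add_left c d e]
    have e₅ : sgn k (a + b + c) d = sgn k (a + b) d * sgn k c d := sgn_add_left _ _ _
    have e₆ : sgn k c (a + b + d) = sgn k (a + b) c * sgn k c d := by
      rw [sgn_add_right, sgn_comm c]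
    simp only [twistedComm_smul_left, twistedComm_smul_right, e₁, e₂, e₃, e₄, e₅, e₆,
      sgn_add_left c d e, sgn_comm c (a + b), sgn_add_right (a + b) c d]
    rw [key]
    module

end RightAltSuper

/-- A right alternative superalgebra with the ternary product
`[x,y,z] = 2(-1)^{|x|(|y|+|z|)} as^J(y,z,x)` of the super-Jordan product is a Lie
supertriple system. -/
theorem rightAltSuper_lieSupertriple (R : RightAltSuper k A) :
    ∃ L : LieSupertriple k A, L.grading = R.grading ∧
      (∀ (a b c : ZMod 2) (x y z : A), x ∈ R.grading a → y ∈ R.grading b → z ∈ R.grading c →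
        L.tp x y z = (2 : k) • sgn k a (b + c) • jassoc k A R b c a y z x) := by
  exact ⟨{
    grading := R.grading
    internal := R.internal
    tp := R.triple
    tp_grade := fun _ _ _ _ _ _ hx hy hz => R.triple_mem hx hy hz
    anti := fun _ _ _ _ z hx hy => R.triple_anti hx hy z
    cyclic := fun _ _ _ _ _ _ hx hy hz => R.triple_cyclic hx hy hz
    deriv := fun _ _ _ _ _ _ _ _ w hx hy hu hv => R.triple_deriv hx hy hu hv w },
    rfl, fun _ _ _ _ _ _ hx hy hz => R.triple_eq_jassoc hx hy hz⟩

end SuperAlg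
end
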